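/- At every point of $\mathbb{R}^9$, the values of the nine vector fields $\zeta_1, \zeta_2, \zeta_3, \zeta_5, \zeta_6, \zeta_8, \zeta_{10}, \zeta_{12}, \zeta_{15}$ form a basis of $\mathbb{R}^9$. In particular, the rank-3 distribution spanned by $\zeta_1, \zeta_2, \zeta_3$ is bracket-generating: together with the iterated Lie brackets $\zeta_5 = [\zeta_1,\zeta_2]$, $\zeta_6 = [\zeta_2,\zeta_3]$, $\zeta_8 = [\zeta_1,\zeta_6]$, $\zeta_{10} = [\zeta_3,\zeta_6]$, $\zeta_{12} = [\zeta_1,\zeta_{10}]$, $\zeta_{15} = [\zeta_2,\zeta_{12}]$ it spans the full tangent space at every point. -/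

import Mathlib

noncomputable section

/- Coordinates on `ℝ⁹`:
index 0 = z₁₁, 1 = z₁₃, 2 = z₁₄, 3 = z₁₅, 4 = z₁₆, 5 = z₂₁, 6 = z₂₄, 7 = z₂₅, 8 = z₃₁. -/

/-- Standard basis vector. -/
def e (i : Fin 9) : Fin 9 → ℝ := Pi.single i 1

/-- Lie bracket of vector fields on `ℝ⁹`: `[V,W](x) = DW(x)(V(x)) - DV(x)(W(x))`. -/
def vfBracket (V W : (Fin 9 → ℝ) → (Fin 9 → ℝ)) : (Fin 9 → ℝ) → (Fin 9 → ℝ) :=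
  fun x => fderiv ℝ W x (V x) - fderiv ℝ V x (W x)

def ζ1 : (Fin 9 → ℝ) → (Fin 9 → ℝ) :=
  fun m => e 1 + m 5 • e 0 + m 6 • e 2 + m 7 • e 3
    + (m 6 * m 7 - (1/4) * m 5 ^ 2) • e 4
def ζ2 : (Fin 9 → ℝ) → (Fin 9 → ℝ) :=
  fun m => e 6 + m 8 • e 5 + ((1/4) * m 8 ^ 2) • e 7
def ζ3 : (Fin 9 → ℝ) → (Fin 9 → ℝ) :=
  fun _ => e 8
def ζ5 : (Fin 9 → ℝ) → (Fin 9 → ℝ) :=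
  fun m => -e 2 - m 8 • e 0 - ((1/4) * m 8 ^ 2) • e 3
    + (-m 7 + (1/2) * m 5 * m 8 - (1/4) * m 6 * m 8 ^ 2) • e 4
def ζ6 : (Fin 9 → ℝ) → (Fin 9 → ℝ) :=
  fun m => -e 5 - ((1/2) * m 8) • e 7
def ζ8 : (Fin 9 → ℝ) → (Fin 9 → ℝ) :=
  fun m => e 0 + ((1/2) * m 8) • e 3 + (-(1/2) * m 5 + (1/2) * m 6 * m 8) • e 4
def ζ10 : (Fin 9 → ℝ) → (Fin 9 → ℝ) :=
  fun _ => -(1/2 : ℝ) • e 7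
def ζ12 : (Fin 9 → ℝ) → (Fin 9 → ℝ) :=
  fun m => (1/2 : ℝ) • e 3 + ((1/2) * m 6) • e 4
def ζ15 : (Fin 9 → ℝ) → (Fin 9 → ℝ) :=
  fun _ => (1/2 : ℝ) • e 4

theorem hasFDerivAt_coord (i : Fin 9) (x : Fin 9 → ℝ) :
    HasFDerivAt (fun m : Fin 9 → ℝ => m i) (ContinuousLinearMap.proj (R := ℝ) i) x :=
  hasFDerivAt_apply i x

theorem fderiv_ζ1 (x v : Fin 9 → ℝ) :
    fderiv ℝ ζ1 x v = v 5 • e 0 + v 6 • e 2 + v 7 • e 3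
      + (v 6 * x 7 + x 6 * v 7 - (1/2) * x 5 * v 5) • e 4 := by
  have h := (((((hasFDerivAt_coord 5 x).smul_const (e 0)).const_add (e 1)).add
    ((hasFDerivAt_coord 6 x).smul_const (e 2))).add
    ((hasFDerivAt_coord 7 x).smul_const (e 3))).add
    ((((hasFDerivAt_coord 6 x).mul (hasFDerivAt_coord 7 x)).sub
      (((hasFDerivAt_coord 5 x).pow 2).const_mul (1/4))).smul_const (e 4))
  have h' : fderiv ℝ ζ1 x = _ := h.fderiv
  rw [h']
  ext i
  simp [-mul_eq_mul_right_iff]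
  ring

theorem fderiv_ζ2 (x v : Fin 9 → ℝ) :
    fderiv ℝ ζ2 x v = v 8 • e 5 + ((1/2) * x 8 * v 8) • e 7 := by
  have h := (((hasFDerivAt_coord 8 x).smul_const (e 5)).const_add (e 6)).add
    ((((hasFDerivAt_coord 8 x).pow 2).const_mul (1/4)).smul_const (e 7))
  have h' : fderiv ℝ ζ2 x = _ := h.fderiv
  rw [h']
  ext i
  simp [-mul_eq_mul_right_iff]
  ring

theorem fderiv_ζ6 (x v : Fin 9 → ℝ) :
    fderiv ℝ ζ6 x v = -((1/2) * v 8) • e 7 := by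
  have h := (((hasFDerivAt_coord 8 x).const_mul (1/2)).smul_const (e 7)).const_sub (-e 5)
  have h' : fderiv ℝ ζ6 x = _ := h.fderiv
  rw [h']
  ext i
  simp

theorem fderiv_ζ12 (x v : Fin 9 → ℝ) :
    fderiv ℝ ζ12 x v = ((1/2) * v 6) • e 4 := by
  have h := (((hasFDerivAt_coord 6 x).const_mul (1/2)).smul_const (e 4)).const_add
    ((1/2 : ℝ) • e 3)
  have h' : fderiv ℝ ζ12 x = _ := h.fderiv
  rw [h']
  ext i
  simp

theorem fderiv_ζ3 (x : Fin 9 → ℝ) : fderiv ℝ ζ3 x = 0 :=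
  fderiv_const_apply (e 8)

theorem fderiv_ζ10 (x : Fin 9 → ℝ) : fderiv ℝ ζ10 x = 0 :=
  fderiv_const_apply (-(1/2 : ℝ) • e 7)

theorem span_ζ_eq_top (m : Fin 9 → ℝ) :
    Submodule.span ℝ
      (Set.range ![ζ1 m, ζ2 m, ζ3 m, ζ5 m, ζ6 m, ζ8 m, ζ10 m, ζ12 m, ζ15 m]) = ⊤ := by
  rw [Submodule.eq_top_iff']
  intro v
  rw [Submodule.mem_span_range_iff_exists_fun]
  -- The frame is triangular after reordering, so the coefficients come from back substitution.
  let a5 := v 1 * m 6 - v 2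
  let a6 := v 6 * m 8 - v 5
  let a8 := v 0 - v 1 * m 5 + a5 * m 8
  let a10 := 2 * (v 6 * ((1/4) * m 8 ^ 2) - a6 * ((1/2) * m 8) - v 7)
  let a12 := 2 * (v 3 - v 1 * m 7 + a5 * ((1/4) * m 8 ^ 2) - a8 * ((1/2) * m 8))
  let a15 := 2 * (v 4 - v 1 * (m 6 * m 7 - (1/4) * m 5 ^ 2)
    - a5 * (-m 7 + (1/2) * m 5 * m 8 - (1/4) * m 6 * m 8 ^ 2)
    - a8 * (-(1/2) * m 5 + (1/2) * m 6 * m 8) - a12 * ((1/2) * m 6))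
  refine ⟨![v 1, v 6, v 8, a5, a6, a8, a10, a12, a15], ?_⟩
  ext i
  fin_cases i <;>
    simp [Fin.sum_univ_succ, ζ1, ζ2, ζ3, ζ5, ζ6, ζ8, ζ10, ζ12, ζ15, e, a5, a6, a8, a10, a12,
      a15] <;>
    ring

/-- At every point of `ℝ⁹`, the values of `ζ₁, ζ₂, ζ₃` together with the iterated brackets
`ζ₅ = [ζ₁,ζ₂]`, `ζ₆ = [ζ₂,ζ₃]`, `ζ₈ = [ζ₁,ζ₆]`, `ζ₁₀ = [ζ₃,ζ₆]`, `ζ₁₂ = [ζ₁,ζ₁₀]`,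
`ζ₁₅ = [ζ₂,ζ₁₂]` form a basis of `ℝ⁹`: the rank-3 distribution spanned by `ζ₁, ζ₂, ζ₃` is
bracket-generating. -/
theorem zeta_frame_basis :
    vfBracket ζ1 ζ2 = ζ5 ∧ vfBracket ζ2 ζ3 = ζ6 ∧ vfBracket ζ1 ζ6 = ζ8 ∧
    vfBracket ζ3 ζ6 = ζ10 ∧ vfBracket ζ1 ζ10 = ζ12 ∧ vfBracket ζ2 ζ12 = ζ15 ∧
    ∀ m : Fin 9 → ℝ,
      LinearIndependent ℝ ![ζ1 m, ζ2 m, ζ3 m, ζ5 m, ζ6 m, ζ8 m, ζ10 m, ζ12 m, ζ15 m] ∧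
      Submodule.span ℝ
        (Set.range ![ζ1 m, ζ2 m, ζ3 m, ζ5 m, ζ6 m, ζ8 m, ζ10 m, ζ12 m, ζ15 m]) = ⊤ := by
  refine ⟨?_, ?_, ?_, ?_, ?_, ?_, fun m =>
    ⟨linearIndependent_of_top_le_span_of_card_eq_finrank (span_ζ_eq_top m).ge (by simp),
      span_ζ_eq_top m⟩⟩
  all_goals
    ext x i
    simp only [vfBracket, fderiv_ζ1, fderiv_ζ2, fderiv_ζ3, fderiv_ζ6, fderiv_ζ10, fderiv_ζ12]
    fin_cases i <;>
      simp [ζ1, ζ2, ζ3, ζ5, ζ6, ζ8, ζ10, ζ12, ζ15, e] <;>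
      ring

end
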